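/- arXiv:2110.00884 — 4 statements merged into one kernel-verified Lean document; each statement's English description precedes it below -/
import Mathlib

section
/- Fix n ≥ L+1. Suppose the user-specified density μ_{n-L} equals the one-step predictive density π_{(n-L+1|n-L)}(x') := ∫_X π_{(n-L)}(x) f(x,x') dx (dx-almost everywhere), where π_{(k)} denotes the time-k marginal of the smoothing distribution π_k. Then the marginal of the lagged target \hat{π}_n on the coordinates (x_{n-L+1},…,x_n) coincides with the marginal of the true smoothing distribution π_n on the coordinates (x_{n-L+1},…,x_n); in particular the lagged filter marginal equals the true filter π_{(n)}. -/
open MeasureTheory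
open scoped ENNReal NNReal

/-- Normalization of the measure with density `ρ` (interpreted via `ENNReal.ofReal`) with
respect to `base`: the "probability measure with density proportional to `ρ`". -/
noncomputable def normMeasure {α : Type*} [MeasurableSpace α] (base : Measure α) (ρ : α → ℝ) :
    Measure α :=
  (∫⁻ a, ENNReal.ofReal (ρ a) ∂base)⁻¹ • base.withDensity fun a => ENNReal.ofReal (ρ a)

/-- The previous state `x_{i-1}` of a path `x = (x_1, …, x_n)` (0-based: `x 0, …, x (n-1)`),
with the convention that the state before `x_1` is the fixed initial condition `x₀`. -/
def prevCoord {X : Type*} (x0 : X) {n : ℕ} (x : Fin n → X) (i : Fin n) : X :=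
  if (i : ℕ) = 0 then x0 else x ⟨(i : ℕ) - 1, lt_of_le_of_lt (Nat.sub_le _ _) i.isLt⟩

/-- The unnormalized smoothing density `γ_n(x_{1:n}) = ∏_{p=1}^n f(x_{p-1},x_p) g(x_p,y_p)`. -/
noncomputable def smoothDensity {X Y : Type*} (f : X → X → ℝ) (g : X → Y → ℝ)
    (x0 : X) (y : ℕ → Y) (n : ℕ) (x : Fin n → X) : ℝ :=
  ∏ i : Fin n, (f (prevCoord x0 x i) (x i) * g (x i) (y ((i : ℕ) + 1)))

/-- The smoothing distribution `π_n`, i.e. the probability measure on `X^n` with density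
proportional to `∏_{p=1}^n f(x_{p-1},x_p) g(x_p,y_p)`. -/
noncomputable def smoothMeasure {X Y : Type*} [MeasurableSpace X] (dx : Measure X)
    (f : X → X → ℝ) (g : X → Y → ℝ) (x0 : X) (y : ℕ → Y) (n : ℕ) : Measure (Fin n → X) :=
  normMeasure (Measure.pi fun _ : Fin n => dx) (smoothDensity f g x0 y n)

/-- The function `α_p(x_{1:p})`, defined by `α₁(x₁) = g(x₁,y₁) f(x₀,x₁)` and
`α_{p+1}(x_{1:p+1}) = α_p(x_{1:p}) μ_p(x_{p+1}) g(x_{p+1},y_{p+1})` (closed form). -/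
noncomputable def alphaDensity {X Y : Type*} (f : X → X → ℝ) (g : X → Y → ℝ)
    (μ : ℕ → X → ℝ) (x0 : X) (y : ℕ → Y) (p : ℕ) (x : Fin p → X) : ℝ :=
  ∏ i : Fin p,
    if (i : ℕ) = 0 then f x0 (x i) * g (x i) (y 1)
    else μ (i : ℕ) (x i) * g (x i) (y ((i : ℕ) + 1))

/-- The unnormalized lagged target density
`γ̂_n(x_{1:n}) = α_{n-L}(x_{1:n-L}) · μ_{n-L}(x_{n-L+1}) g(x_{n-L+1},y_{n-L+1})
  · ∏_{p=n-L+2}^n f(x_{p-1},x_p) g(x_p,y_p)`, for `1 ≤ L` and `L + 1 ≤ n`. -/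
noncomputable def hatDensity {X Y : Type*} (f : X → X → ℝ) (g : X → Y → ℝ)
    (μ : ℕ → X → ℝ) (x0 : X) (y : ℕ → Y) (L n : ℕ) (hL : 1 ≤ L) (hn : L + 1 ≤ n)
    (x : Fin n → X) : ℝ :=
  alphaDensity f g μ x0 y (n - L) (fun i => x (Fin.castLE (Nat.sub_le n L) i)) *
    (μ (n - L) (x ⟨n - L, by omega⟩) * g (x ⟨n - L, by omega⟩) (y (n - L + 1))) *
    ∏ i : Fin n,
      if n - L + 1 ≤ (i : ℕ) then
        f (x ⟨(i : ℕ) - 1, lt_of_le_of_lt (Nat.sub_le _ _) i.isLt⟩) (x i) *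
          g (x i) (y ((i : ℕ) + 1))
      else 1

/-- The lagged target `π̂_n`: the probability measure on `X^n` with density proportional
to `γ̂_n`. -/
noncomputable def hatMeasure {X Y : Type*} [MeasurableSpace X] (dx : Measure X)
    (f : X → X → ℝ) (g : X → Y → ℝ) (μ : ℕ → X → ℝ) (x0 : X) (y : ℕ → Y)
    (L n : ℕ) (hL : 1 ≤ L) (hn : L + 1 ≤ n) : Measure (Fin n → X) :=
  normMeasure (Measure.pi fun _ : Fin n => dx) (hatDensity f g μ x0 y L n hL hn)

/-- Projection of a path `x_{1:n}` onto its last `L` coordinates `(x_{n-L+1},…,x_n)`. -/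
def lastBlock {X : Type*} (L n : ℕ) (hn : L ≤ n) (x : Fin n → X) : Fin L → X :=
  fun i => x ⟨n - L + (i : ℕ), by omega⟩

/-- Splitting a path into its first `n - L` and its last `L` coordinates preserves the product
measure. -/
theorem measurePreserving_prod_lastBlock {X : Type*} [MeasurableSpace X] (dx : Measure X)
    [SigmaFinite dx] {L n : ℕ} (hn : L ≤ n) :
    MeasurePreserving
      (fun x : Fin n → X =>
        ((fun i => x (Fin.castLE (Nat.sub_le n L) i) : Fin (n - L) → X), lastBlock L n hn x))
      (Measure.pi fun _ : Fin n => dx)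
      ((Measure.pi fun _ : Fin (n - L) => dx).prod (Measure.pi fun _ : Fin L => dx)) := by
  let e : Fin (n - L) ⊕ Fin L ≃ Fin n :=
    finSumFinEquiv.trans (finCongr (Nat.sub_add_cancel hn))
  exact (measurePreserving_sumPiEquivProdPi fun _ : Fin (n - L) ⊕ Fin L => dx).comp
    (measurePreserving_piCongrLeft (fun _ : Fin n => dx) e).symm

theorem Fin.prod_castLE_mul_prod_sub_add {M : Type*} [CommMonoid M] {L n : ℕ} (hn : L ≤ n)
    (h : Fin n → M) :
    ∏ i, h i = (∏ i : Fin (n - L), h (Fin.castLE (Nat.sub_le n L) i)) *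
      ∏ i : Fin L, h ⟨n - L + i, by omega⟩ := by
  rw [← (finSumFinEquiv.trans (finCongr (Nat.sub_add_cancel hn))).prod_comp,
    Fintype.prod_sum_type]
  rfl

/-- If, after a measure-preserving splitting, integrating out the first component of a density
gives a multiple of `M`, then the second marginal of the normalized measure is the normalization
of `M`. -/
theorem map_snd_normMeasure {α β γ : Type*} [MeasurableSpace α] [MeasurableSpace β]
    [MeasurableSpace γ] {base : Measure α} {ν₁ : Measure β} {ν₂ : Measure γ} [SFinite ν₁]
    [SFinite ν₂] {p : α → β × γ} (hp : MeasurePreserving p base (ν₁.prod ν₂)) {ρ : α → ℝ}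
    {F : β × γ → ℝ≥0∞} (hF : Measurable F) (hρ : ∀ x, ENNReal.ofReal (ρ x) = F (p x))
    {M : γ → ℝ≥0∞} (hM : Measurable M) {k : ℝ≥0∞}
    (hFM : ∀ᵐ c ∂ν₂, ∫⁻ b, F (b, c) ∂ν₁ = k * M c)
    (h0 : ∫⁻ x, ENNReal.ofReal (ρ x) ∂base ≠ 0) (htop : ∫⁻ x, ENNReal.ofReal (ρ x) ∂base ≠ ⊤) :
    (normMeasure base ρ).map (fun x => (p x).2) = (∫⁻ c, M c ∂ν₂)⁻¹ • ν₂.withDensity M := by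
  have hset : ∀ s, MeasurableSet s →
      ∫⁻ x in (fun x => (p x).2) ⁻¹' s, ENNReal.ofReal (ρ x) ∂base = k * ∫⁻ c in s, M c ∂ν₂ := by
    intro s hs
    have hpre : (fun x => (p x).2) ⁻¹' s = p ⁻¹' (Set.univ ×ˢ s) := by ext; simp
    simp only [hρ, hpre]
    rw [hp.setLIntegral_comp_preimage (MeasurableSet.univ.prod hs) hF, ← Measure.prod_restrict,
      Measure.restrict_univ, lintegral_prod_symm' _ hF,
      lintegral_congr_ae (ae_restrict_of_ae hFM), lintegral_const_mul _ hM]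
  have hZ : ∫⁻ x, ENNReal.ofReal (ρ x) ∂base = k * ∫⁻ c, M c ∂ν₂ := by
    simpa using hset Set.univ MeasurableSet.univ
  have hp2 : Measurable fun x => (p x).2 := hp.measurable.snd
  have hk0 : k ≠ 0 := by rintro rfl; simp [hZ] at h0
  have hM0 : ∫⁻ c, M c ∂ν₂ ≠ 0 := by intro h; simp [hZ, h] at h0
  have hktop : k ≠ ⊤ := by rintro rfl; simp [hZ, ENNReal.top_mul hM0] at htop
  ext s hs
  rw [Measure.map_apply hp2 hs, normMeasure, Measure.smul_apply, Measure.smul_apply,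
    withDensity_apply _ (hp2 hs), withDensity_apply _ hs, hset s hs, hZ, smul_eq_mul, smul_eq_mul,
    ENNReal.mul_inv (Or.inl hk0) (Or.inl hktop), mul_mul_mul_comm,
    ENNReal.inv_mul_cancel hk0 hktop, one_mul]

/-- The factor of the lagged target and of the smoothing density that only involves the last `L`
coordinates. -/
noncomputable def tailDensity {X Y : Type*} (f : X → X → ℝ) (g : X → Y → ℝ) (y : ℕ → Y)
    (m L : ℕ) (b : Fin L → X) : ℝ :=
  ∏ i : Fin L,
    (if (i : ℕ) = 0 then 1 else f (b ⟨(i : ℕ) - 1, lt_of_le_of_lt (Nat.sub_le _ _) i.isLt⟩) (b i)) *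
      g (b i) (y (m + i + 1))

section Factorization

variable {X Y : Type*} (f : X → X → ℝ) (g : X → Y → ℝ) (μ : ℕ → X → ℝ) (x0 : X) (y : ℕ → Y)

theorem smoothDensity_eq_mul_tailDensity {L n : ℕ} (hL : 1 ≤ L) (hn : L + 1 ≤ n)
    (x : Fin n → X) :
    smoothDensity f g x0 y n x =
      smoothDensity f g x0 y (n - L) (fun i => x (Fin.castLE (Nat.sub_le n L) i)) *
        f (x ⟨n - L - 1, by omega⟩) (x ⟨n - L, by omega⟩) *
        tailDensity f g y (n - L) L (lastBlock L n (Nat.le_of_succ_le hn) x) := by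
  obtain ⟨L, rfl⟩ := Nat.exists_eq_add_of_le' hL
  rw [smoothDensity, Fin.prod_castLE_mul_prod_sub_add (show L + 1 ≤ n by omega), mul_assoc]
  congr 1
  rw [tailDensity, Fin.prod_univ_succ, Fin.prod_univ_succ, ← mul_assoc]
  have hne : n - (L + 1) ≠ 0 := by omega
  congr 1
  simp [prevCoord, lastBlock, hne]

theorem hatDensity_eq_mul_tailDensity {L n : ℕ} (hL : 1 ≤ L) (hn : L + 1 ≤ n)
    (x : Fin n → X) :
    hatDensity f g μ x0 y L n hL hn x =
      alphaDensity f g μ x0 y (n - L) (fun i => x (Fin.castLE (Nat.sub_le n L) i)) *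
        (μ (n - L) (x ⟨n - L, by omega⟩) *
          tailDensity f g y (n - L) L (lastBlock L n (Nat.le_of_succ_le hn) x)) := by
  obtain ⟨L, rfl⟩ := Nat.exists_eq_add_of_le' hL
  rw [hatDensity, mul_assoc, mul_assoc]
  congr 2
  rw [Fin.prod_castLE_mul_prod_sub_add (show L + 1 ≤ n by omega), Finset.prod_eq_one, one_mul,
    tailDensity, Fin.prod_univ_succ, Fin.prod_univ_succ, ← mul_assoc]
  · congr 1
    · simp [lastBlock]
    · refine Finset.prod_congr rfl fun i _ => ?_
      simp [lastBlock]
  · intro i _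
    rw [if_neg]
    simp

variable {f g μ}

theorem smoothDensity_nonneg (hf : ∀ a b, 0 ≤ f a b) (hg : ∀ a b, 0 ≤ g a b) (n : ℕ)
    (x : Fin n → X) : 0 ≤ smoothDensity f g x0 y n x :=
  Finset.prod_nonneg fun _ _ => mul_nonneg (hf _ _) (hg _ _)

theorem alphaDensity_nonneg (hf : ∀ a b, 0 ≤ f a b) (hg : ∀ a b, 0 ≤ g a b)
    (hμ : ∀ p a, 0 ≤ μ p a) (n : ℕ) (x : Fin n → X) : 0 ≤ alphaDensity f g μ x0 y n x :=
  Finset.prod_nonneg fun i _ => by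
    split_ifs
    exacts [mul_nonneg (hf _ _) (hg _ _), mul_nonneg (hμ _ _) (hg _ _)]

variable [MeasurableSpace X] [MeasurableSpace Y]

theorem measurable_smoothDensity (hf : Measurable (Function.uncurry f))
    (hg : Measurable (Function.uncurry g)) (n : ℕ) : Measurable (smoothDensity f g x0 y n) := by
  have hprev : ∀ i : Fin n, Measurable fun x : Fin n → X => prevCoord x0 x i := fun i => by
    unfold prevCoord
    split_ifs
    exacts [measurable_const, measurable_pi_apply _]
  refine Finset.measurable_prod _ fun i _ => Measurable.mul ?_ ?_
  · exact hf.comp ((hprev i).prodMk (measurable_pi_apply i))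
  · exact hg.of_uncurry_right.comp (measurable_pi_apply i)

theorem measurable_alphaDensity (hf : Measurable (Function.uncurry f))
    (hg : Measurable (Function.uncurry g)) (hμ : ∀ p, Measurable (μ p)) (n : ℕ) :
    Measurable (alphaDensity f g μ x0 y n) := by
  refine Finset.measurable_prod _ fun i _ => ?_
  split_ifs
  · exact (hf.of_uncurry_left.comp (measurable_pi_apply i)).mul
      (hg.of_uncurry_right.comp (measurable_pi_apply i))
  · exact ((hμ _).comp (measurable_pi_apply i)).mul
      (hg.of_uncurry_right.comp (measurable_pi_apply i))

theorem measurable_tailDensity (hf : Measurable (Function.uncurry f))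
    (hg : Measurable (Function.uncurry g)) (m L : ℕ) : Measurable (tailDensity f g y m L) := by
  refine Finset.measurable_prod _ fun i _ => Measurable.mul ?_ ?_
  · split_ifs
    · exact measurable_const
    · exact hf.comp (Measurable.prodMk (measurable_pi_apply _) (measurable_pi_apply i))
  · exact hg.of_uncurry_right.comp (measurable_pi_apply i)

end Factorization

theorem isProbabilityMeasure_normMeasure {α : Type*} [MeasurableSpace α] {base : Measure α}
    {ρ : α → ℝ} (h0 : ∫⁻ x, ENNReal.ofReal (ρ x) ∂base ≠ 0)
    (htop : ∫⁻ x, ENNReal.ofReal (ρ x) ∂base ≠ ⊤) : IsProbabilityMeasure (normMeasure base ρ) :=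
  ⟨by simp [normMeasure, ENNReal.inv_mul_cancel h0 htop]⟩

/-- A transition density averages to a finite function under a probability measure. -/
theorem ae_ofReal_integral_kernel_eq_lintegral {X : Type*} [MeasurableSpace X] {dx : Measure X}
    [SigmaFinite dx] {f : X → X → ℝ} (hf : Measurable (Function.uncurry f))
    (hf0 : ∀ a b, 0 ≤ f a b) (hfint : ∀ a, ∫ b, f a b ∂dx = 1) (P : Measure X)
    [IsProbabilityMeasure P] :
    ∀ᵐ b ∂dx, ENNReal.ofReal (∫ a, f a b ∂P) = ∫⁻ a, ENNReal.ofReal (f a b) ∂P := by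
  have hfE : Measurable fun q : X × X => ENNReal.ofReal (f q.1 q.2) := hf.ennreal_ofReal
  have hone : ∀ a, ∫⁻ b, ENNReal.ofReal (f a b) ∂dx = 1 := fun a => by
    rw [← ofReal_integral_eq_lintegral_ofReal
      (Integrable.of_integral_ne_zero (by simp [hfint])) (ae_of_all _ (hf0 a)), hfint,
      ENNReal.ofReal_one]
  have htot : ∫⁻ b, ∫⁻ a, ENNReal.ofReal (f a b) ∂P ∂dx = 1 := by
    rw [lintegral_lintegral_swap (by exact (hfE.comp measurable_swap).aemeasurable)]
    simp [hone]
  have hmeas : Measurable fun b => ∫⁻ a, ENNReal.ofReal (f a b) ∂P := hfE.lintegral_prod_left'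
  filter_upwards [ae_lt_top hmeas (by simp [htot])] with b hb
  rw [integral_eq_lintegral_of_nonneg_ae (ae_of_all _ fun a => hf0 a b)
    (hf.comp (measurable_id.prodMk measurable_const)).aestronglyMeasurable,
    ENNReal.ofReal_toReal hb.ne]

/-- Integration against a pushforward of a normalized measure. -/
theorem lintegral_mul_eq_mul_lintegral_map_normMeasure {α β : Type*} [MeasurableSpace α]
    [MeasurableSpace β] {base : Measure α} {ρ : α → ℝ} (hρ : Measurable ρ)
    (h0 : ∫⁻ x, ENNReal.ofReal (ρ x) ∂base ≠ 0) (htop : ∫⁻ x, ENNReal.ofReal (ρ x) ∂base ≠ ⊤)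
    {φ : α → β} (hφ : Measurable φ) {h : β → ℝ≥0∞} (hh : Measurable h) :
    ∫⁻ x, ENNReal.ofReal (ρ x) * h (φ x) ∂base =
      (∫⁻ x, ENNReal.ofReal (ρ x) ∂base) * ∫⁻ z, h z ∂((normMeasure base ρ).map φ) := by
  rw [lintegral_map hh hφ, normMeasure, lintegral_smul_measure,
    smul_eq_mul, ← mul_assoc, ENNReal.mul_inv_cancel h0 htop, one_mul]
  exact (lintegral_withDensity_eq_lintegral_mul _ hρ.ennreal_ofReal (hh.comp hφ)).symm

/-- Exactness of the lagged approximation under the ideal choice of `μ_{n-L}`.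
If the user-specified density `μ_{n-L}` equals (a.e.) the one-step predictive density
`x' ↦ ∫ π_{(n-L)}(x) f(x,x') dx`, then the marginal of the lagged target `π̂_n` on the
coordinates `(x_{n-L+1},…,x_n)` coincides with that of the true smoothing distribution `π_n`;
in particular the lagged filter marginal equals the true filter `π_{(n)}`. -/
theorem lagged_target_exact_of_predictive
    {X Y : Type*} [MeasurableSpace X] [MeasurableSpace Y]
    (dx : Measure X) [SigmaFinite dx] (x0 : X) (y : ℕ → Y)
    (f : X → X → ℝ) (g : X → Y → ℝ) (μ : ℕ → X → ℝ)
    (hf : Measurable (Function.uncurry f)) (hfpos : ∀ a b, 0 < f a b)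
    (hfint : ∀ a, ∫ b, f a b ∂dx = 1)
    (hg : Measurable (Function.uncurry g)) (hgpos : ∀ a b, 0 < g a b)
    (hgbd : ∃ Cg : ℝ, ∀ a b, g a b ≤ Cg)
    (hμmeas : ∀ p, Measurable (μ p)) (hμnonneg : ∀ p a, 0 ≤ μ p a)
    (hμint : ∀ p, 1 ≤ p → ∫ a, μ p a ∂dx = 1)
    (L n : ℕ) (hL : 1 ≤ L) (hn : L + 1 ≤ n)
    -- the normalizing constants are assumed finite and nonzero:
    (hZn : (∫⁻ x, ENNReal.ofReal (smoothDensity f g x0 y n x)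
        ∂(Measure.pi fun _ : Fin n => dx)) ≠ 0 ∧
      (∫⁻ x, ENNReal.ofReal (smoothDensity f g x0 y n x)
        ∂(Measure.pi fun _ : Fin n => dx)) ≠ ⊤)
    (hZnL : (∫⁻ x, ENNReal.ofReal (smoothDensity f g x0 y (n - L) x)
        ∂(Measure.pi fun _ : Fin (n - L) => dx)) ≠ 0 ∧
      (∫⁻ x, ENNReal.ofReal (smoothDensity f g x0 y (n - L) x)
        ∂(Measure.pi fun _ : Fin (n - L) => dx)) ≠ ⊤)
    (hZhat : (∫⁻ x, ENNReal.ofReal (hatDensity f g μ x0 y L n hL hn x)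
        ∂(Measure.pi fun _ : Fin n => dx)) ≠ 0 ∧
      (∫⁻ x, ENNReal.ofReal (hatDensity f g μ x0 y L n hL hn x)
        ∂(Measure.pi fun _ : Fin n => dx)) ≠ ⊤)
    -- `μ_{n-L}` equals the one-step predictive density `π_{(n-L+1|n-L)}` a.e.:
    (hpred : ∀ᵐ x' ∂dx, μ (n - L) x' =
      ∫ z, f z x' ∂((smoothMeasure dx f g x0 y (n - L)).map
        (fun x => x ⟨n - L - 1, by omega⟩))) :
    (hatMeasure dx f g μ x0 y L n hL hn).map (lastBlock L n (by omega)) =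
      (smoothMeasure dx f g x0 y n).map (lastBlock L n (by omega)) ∧
    (hatMeasure dx f g μ x0 y L n hL hn).map (fun x => x ⟨n - 1, by omega⟩) =
      (smoothMeasure dx f g x0 y n).map (fun x => x ⟨n - 1, by omega⟩) := by
  have hLn : L ≤ n := by omega
  have hf0 : ∀ a b, 0 ≤ f a b := fun a b => (hfpos a b).le
  have hg0 : ∀ a b, 0 ≤ g a b := fun a b => (hgpos a b).le
  have hp := measurePreserving_prod_lastBlock dx hLn
  have hblock : Measurable (lastBlock (X := X) L n hLn) := hp.measurable.snd
  have hlast : Measurable fun a : Fin (n - L) → X => a ⟨n - L - 1, by omega⟩ :=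
    measurable_pi_apply _
  have hT := measurable_tailDensity y hf hg (n - L) L
  let M : (Fin L → X) → ℝ≥0∞ := fun b =>
    ENNReal.ofReal (μ (n - L) (b ⟨0, hL⟩) * tailDensity f g y (n - L) L b)
  have hM : Measurable M := by
    exact (((hμmeas _).comp (measurable_pi_apply _)).mul hT).ennreal_ofReal
  have hhat : (hatMeasure dx f g μ x0 y L n hL hn).map (lastBlock L n hLn) =
      (∫⁻ b, M b ∂(Measure.pi fun _ : Fin L => dx))⁻¹ •
        (Measure.pi fun _ : Fin L => dx).withDensity M := by
    have hα := (measurable_alphaDensity x0 y hf hg hμmeas (n - L)).ennreal_ofReal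
    refine map_snd_normMeasure hp
      (F := fun q => ENNReal.ofReal (alphaDensity f g μ x0 y (n - L) q.1) * M q.2)
      ((hα.comp measurable_fst).mul (hM.comp measurable_snd)) (fun x => ?_) hM
      (ae_of_all _ fun b => lintegral_mul_const (M b) hα) hZhat.1 hZhat.2
    rw [hatDensity_eq_mul_tailDensity,
      ENNReal.ofReal_mul (alphaDensity_nonneg x0 y hf0 hg0 hμnonneg _ _)]
    rfl
  have hsmooth : (smoothMeasure dx f g x0 y n).map (lastBlock L n hLn) =
      (∫⁻ b, M b ∂(Measure.pi fun _ : Fin L => dx))⁻¹ •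
        (Measure.pi fun _ : Fin L => dx).withDensity M := by
    have hγ := measurable_smoothDensity x0 y hf hg (n - L)
    have hfE : Measurable fun q : X × X => ENNReal.ofReal (f q.1 q.2) := hf.ennreal_ofReal
    have : IsProbabilityMeasure (smoothMeasure dx f g x0 y (n - L)) :=
      isProbabilityMeasure_normMeasure hZnL.1 hZnL.2
    have := Measure.isProbabilityMeasure_map (μ := smoothMeasure dx f g x0 y (n - L))
      hlast.aemeasurable
    have hpredE : ∀ᵐ x' ∂dx,
        ∫⁻ a, ENNReal.ofReal (smoothDensity f g x0 y (n - L) a) *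
            ENNReal.ofReal (f (a ⟨n - L - 1, by omega⟩) x')
            ∂(Measure.pi fun _ : Fin (n - L) => dx) =
          (∫⁻ a, ENNReal.ofReal (smoothDensity f g x0 y (n - L) a)
            ∂(Measure.pi fun _ : Fin (n - L) => dx)) * ENNReal.ofReal (μ (n - L) x') := by
      filter_upwards [hpred, ae_ofReal_integral_kernel_eq_lintegral hf hf0 hfint
        ((smoothMeasure dx f g x0 y (n - L)).map fun a => a ⟨n - L - 1, by omega⟩)]
        with x' h₁ h₂
      rw [h₁, h₂]
      exact lintegral_mul_eq_mul_lintegral_map_normMeasure hγ hZnL.1 hZnL.2 hlast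
        (h := fun z => ENNReal.ofReal (f z x'))
        (hfE.comp (measurable_id.prodMk measurable_const))
    have hγf : Measurable fun q : (Fin (n - L) → X) × (Fin L → X) =>
        ENNReal.ofReal (smoothDensity f g x0 y (n - L) q.1) *
          ENNReal.ofReal (f (q.1 ⟨n - L - 1, by omega⟩) (q.2 ⟨0, hL⟩)) :=
      (hγ.ennreal_ofReal.comp measurable_fst).mul (hfE.comp
        ((hlast.comp measurable_fst).prodMk ((measurable_pi_apply _).comp measurable_snd)))
    refine map_snd_normMeasure hp
      (F := fun q => ENNReal.ofReal (smoothDensity f g x0 y (n - L) q.1) *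
        ENNReal.ofReal (f (q.1 ⟨n - L - 1, by omega⟩) (q.2 ⟨0, hL⟩)) *
          ENNReal.ofReal (tailDensity f g y (n - L) L q.2))
      (hγf.mul (hT.ennreal_ofReal.comp measurable_snd)) (fun x => ?_) hM
      (k := ∫⁻ a, ENNReal.ofReal (smoothDensity f g x0 y (n - L) a)
        ∂(Measure.pi fun _ : Fin (n - L) => dx)) ?_ hZn.1 hZn.2
    · have hγ0 := smoothDensity_nonneg x0 y hf0 hg0 (n - L)
      rw [smoothDensity_eq_mul_tailDensity f g x0 y hL hn,
        ENNReal.ofReal_mul (mul_nonneg (hγ0 _) (hf0 _ _)), ENNReal.ofReal_mul (hγ0 _)]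
      rfl
    · filter_upwards [(Measure.quasiMeasurePreserving_eval (fun _ : Fin L => dx) ⟨0, hL⟩).ae
        hpredE] with b hb
      have hγfb := hγf.comp (measurable_id.prodMk (measurable_const (a := b)))
      refine (lintegral_mul_const (ENNReal.ofReal (tailDensity f g y (n - L) L b)) hγfb).trans ?_
      refine (congrArg (· * _) hb).trans ?_
      rw [mul_assoc, ← ENNReal.ofReal_mul (hμnonneg _ _)]
  have hmain := hhat.trans hsmooth.symm
  refine ⟨hmain, ?_⟩
  have hfilter : (fun x : Fin n → X => x ⟨n - 1, by omega⟩) =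
      (fun b : Fin L → X => b ⟨L - 1, by omega⟩) ∘ lastBlock L n hLn := by
    funext x
    simp only [Function.comp, lastBlock]
    congr 2
    omega
  rw [hfilter, ← Measure.map_map (measurable_pi_apply _) hblock, hmain,
    Measure.map_map (measurable_pi_apply _) hblock]
end

section
/- (Stability of the Bayes/Boltzmann–Gibbs update.) Let (S,𝒮) be a measurable space, 0 < ε ≤ M < ∞, and h : S → ℝ measurable with ε ≤ h(x) ≤ M for all x ∈ S. Define, for a probability measure μ on S, the updated probability measure Ψ_h(μ)(A) := ( ∫_A h dμ ) / ( ∫_S h dμ ). Then for all probability measures μ, ν on S: ‖Ψ_h(μ) − Ψ_h(ν)‖_TV ≤ 2 (M/ε) ‖μ − ν‖_TV. -/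
open MeasureTheory

/-- Total variation distance `‖μ−ν‖_TV := sup_A |μ(A) − ν(A)|`, supremum over measurable sets. -/
noncomputable def tvDist {α : Type*} [MeasurableSpace α] (μ ν : Measure α) : ℝ :=
  ⨆ s : {s : Set α // MeasurableSet s}, |(μ s.1).toReal - (ν s.1).toReal|

/-- The Bayes/Boltzmann–Gibbs update `Ψ_h(μ)(A) = (∫_A h dμ) / (∫_S h dμ)`. -/
noncomputable def bayesUpdate {S : Type*} [MeasurableSpace S] (h : S → ℝ) (μ : Measure S) :
    Measure S :=
  (∫⁻ x, ENNReal.ofReal (h x) ∂μ)⁻¹ • μ.withDensity fun x => ENNReal.ofReal (h x)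

lemma abs_measureReal_sub_le_tvDist {α : Type*} [MeasurableSpace α] (μ ν : Measure α)
    [IsProbabilityMeasure μ] [IsProbabilityMeasure ν] {s : Set α} (hs : MeasurableSet s) :
    |μ.real s - ν.real s| ≤ tvDist μ ν := by
  refine le_ciSup (f := fun s : {s : Set α // MeasurableSet s} =>
    |(μ s.1).toReal - (ν s.1).toReal|) ⟨1, ?_⟩ ⟨s, hs⟩
  rintro _ ⟨t, rfl⟩
  change |μ.real t.1 - ν.real t.1| ≤ 1
  have h₁ : μ.real t.1 ≤ 1 := measureReal_le_one
  have h₂ : ν.real t.1 ≤ 1 := measureReal_le_one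
  have h₃ : 0 ≤ μ.real t.1 := measureReal_nonneg
  have h₄ : 0 ≤ ν.real t.1 := measureReal_nonneg
  exact abs_sub_le_of_nonneg_of_le h₃ h₁ h₄ h₂

/-- Layer-cake bound: integrals of a `[0, M]`-valued function differ by at most `M` times the
total variation distance. -/
lemma abs_integral_sub_le_mul_tvDist {α : Type*} [MeasurableSpace α] (μ ν : Measure α)
    [IsProbabilityMeasure μ] [IsProbabilityMeasure ν] {f : α → ℝ} {M : ℝ} (hM : 0 ≤ M)
    (hf : Measurable f) (hf₀ : ∀ x, 0 ≤ f x) (hfM : ∀ x, f x ≤ M) :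
    |∫ x, f x ∂μ - ∫ x, f x ∂ν| ≤ M * tvDist μ ν := by
  have layer (ρ : Measure α) [IsProbabilityMeasure ρ] :
      ∫ x, f x ∂ρ = ∫ t in (0)..M, ρ.real {a | t ≤ f a} := by
    have hi : Integrable f ρ := .of_bound hf.aestronglyMeasurable M
      (.of_forall fun x => by simpa [abs_of_nonneg (hf₀ x)] using hfM x)
    rw [hi.integral_eq_integral_Ioc_meas_le (.of_forall hf₀) (.of_forall hfM),
      intervalIntegral.integral_of_le hM]
  have integrable (ρ : Measure α) [IsProbabilityMeasure ρ] :
      IntervalIntegrable (fun t => ρ.real {a | t ≤ f a}) volume 0 M :=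
    Antitone.intervalIntegrable fun _ _ hst => measureReal_mono fun _ ha => hst.trans ha
  rw [layer μ, layer ν, ← intervalIntegral.integral_sub (integrable μ) (integrable ν)]
  have bound := intervalIntegral.norm_integral_le_of_norm_le_const (a := 0) (b := M)
    (f := fun t => μ.real {a | t ≤ f a} - ν.real {a | t ≤ f a}) (C := tvDist μ ν)
    fun t _ => abs_measureReal_sub_le_tvDist μ ν (measurableSet_le measurable_const hf)
  simpa [abs_of_nonneg hM, mul_comm] using bound

lemma bayesUpdate_apply_toReal {S : Type*} [MeasurableSpace S] {h : S → ℝ} {μ : Measure S}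
    (hi : Integrable h μ) (h₀ : ∀ x, 0 ≤ h x) {s : Set S} (hs : MeasurableSet s) :
    (bayesUpdate h μ s).toReal = (∫ x in s, h x ∂μ) / ∫ x, h x ∂μ := by
  rw [bayesUpdate, Measure.smul_apply, withDensity_apply _ hs, smul_eq_mul, ENNReal.toReal_mul,
    ENNReal.toReal_inv, integral_eq_lintegral_of_nonneg_ae (.of_forall h₀) hi.1,
    integral_eq_lintegral_of_nonneg_ae (.of_forall h₀) hi.1.restrict, div_eq_inv_mul]

/-- Stability of the Bayes/Boltzmann–Gibbs update.
If `ε ≤ h ≤ M` with `0 < ε ≤ M < ∞`, then for all probability measures `μ, ν`,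
`‖Ψ_h(μ) − Ψ_h(ν)‖_TV ≤ 2 (M/ε) ‖μ − ν‖_TV`. -/
theorem bayesUpdate_tvDist_le {S : Type*} [MeasurableSpace S]
    (ε M : ℝ) (hε : 0 < ε) (hεM : ε ≤ M)
    (h : S → ℝ) (hmeas : Measurable h) (hbd : ∀ x, h x ∈ Set.Icc ε M)
    (μ ν : Measure S) [IsProbabilityMeasure μ] [IsProbabilityMeasure ν] :
    tvDist (bayesUpdate h μ) (bayesUpdate h ν) ≤ 2 * (M / ε) * tvDist μ ν := by
  have h₀ x : 0 ≤ h x := hε.le.trans (hbd x).1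
  have hM : 0 ≤ M := hε.le.trans hεM
  have integrable (ρ : Measure S) [IsProbabilityMeasure ρ] : Integrable h ρ :=
    .of_bound hmeas.aestronglyMeasurable M
      (.of_forall fun x => by simpa [abs_of_nonneg (h₀ x)] using (hbd x).2)
  have le_integral (ρ : Measure S) [IsProbabilityMeasure ρ] : ε ≤ ∫ x, h x ∂ρ := by
    simpa using integral_mono (integrable_const ε) (integrable ρ) fun x => (hbd x).1
  have : Nonempty {s : Set S // MeasurableSet s} := ⟨⟨∅, .empty⟩⟩
  refine ciSup_le fun ⟨s, hs⟩ => ?_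
  rw [bayesUpdate_apply_toReal (integrable μ) h₀ hs, bayesUpdate_apply_toReal (integrable ν) h₀ hs]
  have num := abs_integral_sub_le_mul_tvDist μ ν hM (hmeas.indicator hs)
    (Set.indicator_nonneg fun x _ => h₀ x)
    (fun x => (Set.indicator_le_self' (fun y _ => h₀ y) x).trans (hbd x).2)
  rw [integral_indicator hs, integral_indicator hs] at num
  have den := abs_integral_sub_le_mul_tvDist μ ν hM hmeas h₀ fun x => (hbd x).2
  have hb₀ : 0 ≤ ∫ x in s, h x ∂ν := integral_nonneg h₀
  have hb : ∫ x in s, h x ∂ν ≤ ∫ x, h x ∂ν :=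
    setIntegral_le_integral (integrable ν) (.of_forall h₀)
  have hμ := le_integral μ
  have hν := le_integral ν
  generalize ∫ x in s, h x ∂μ = a at *
  generalize ∫ x in s, h x ∂ν = b at *
  generalize ∫ x, h x ∂μ = p at *
  generalize ∫ x, h x ∂ν = q at *
  have hp : 0 < p := hε.trans_le hμ
  have hq : 0 < q := hε.trans_le hν
  have ratio : |b / q| ≤ 1 := by
    rw [abs_of_nonneg (by positivity)]
    exact div_le_one_of_le₀ hb hq.le
  calc |a / p - b / q| = |(a - b) - b / q * (p - q)| / p := by
        rw [← abs_of_pos hp, ← abs_div, abs_of_pos hp]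
        congr 1
        field_simp
        ring
    _ ≤ (M * tvDist μ ν + 1 * (M * tvDist μ ν)) / p := by
        gcongr
        refine (abs_sub _ _).trans (add_le_add num ?_)
        rw [abs_mul]
        exact mul_le_mul ratio den (abs_nonneg _) zero_le_one
    _ ≤ (M * tvDist μ ν + 1 * (M * tvDist μ ν)) / ε := by
        have := (abs_nonneg _).trans num
        gcongr
    _ = 2 * (M / ε) * tvDist μ ν := by ring
end

section
/- (Well-posedness of the Poisson equation used to define the asymptotic variance σ²(n).) Let K be a Markov kernel on a measurable space (S,𝒮) satisfying the Doeblin minorization K(x,·) ≥ θ ζ(·) for all x, with θ ∈ (0,1] and ζ a probability measure, and let π be its unique invariant probability measure. Then for every bounded measurable φ : S → ℝ, the series \hat{φ}(x) := Σ_{t=0}^{∞} ( K^t φ(x) − π(φ) ) converges absolutely and uniformly in x; the function \hat{φ} is bounded measurable with ‖\hat{φ}‖_∞ ≤ 2 ‖φ‖_∞ / θ, and it solves the Poisson equation \hat{φ} − K\hat{φ} = φ − π(φ). -/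
open MeasureTheory ProbabilityTheory

/-- The action of a Markov kernel on a bounded measurable function: `Kφ(x) = ∫ φ(z) K(x,dz)`. -/
noncomputable def kernelOp {S : Type*} [MeasurableSpace S] (K : Kernel S S) (φ : S → ℝ) :
    S → ℝ :=
  fun x => ∫ z, φ z ∂(K x)

/-- `K^t φ`, the `t`-fold application of the kernel to a function. -/
noncomputable def kernelIter {S : Type*} [MeasurableSpace S] (K : Kernel S S) (t : ℕ)
    (φ : S → ℝ) : S → ℝ :=
  (kernelOp K)^[t] φ

/-- The candidate solution `φ̂(x) = Σ_{t=0}^∞ (K^t φ(x) − π(φ))` of the Poisson equation. -/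
noncomputable def poissonSol {S : Type*} [MeasurableSpace S] (K : Kernel S S) (π : Measure S)
    (φ : S → ℝ) : S → ℝ :=
  fun x => ∑' t : ℕ, (kernelIter K t φ x - ∫ z, φ z ∂π)

theorem integrable_of_measurable_of_mem_Icc {S : Type*} [MeasurableSpace S] {μ : Measure S}
    [IsFiniteMeasure μ] {f : S → ℝ} (hf : Measurable f) {a b : ℝ}
    (hab : ∀ x, f x ∈ Set.Icc a b) : Integrable f μ :=
  Integrable.of_mem_Icc a b hf.aemeasurable (Filter.Eventually.of_forall hab)

theorem integral_mem_Icc {S : Type*} [MeasurableSpace S] {μ : Measure S}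
    [IsProbabilityMeasure μ] {f : S → ℝ} (hf : Measurable f) {a b : ℝ}
    (hab : ∀ x, f x ∈ Set.Icc a b) : ∫ x, f x ∂μ ∈ Set.Icc a b := by
  have hi : Integrable f μ := integrable_of_measurable_of_mem_Icc hf hab
  constructor
  · simpa using integral_mono (μ := μ) (integrable_const a) hi fun x => (hab x).1
  · simpa using integral_mono (μ := μ) hi (integrable_const b) fun x => (hab x).2

theorem measurable_kernelOp {S : Type*} [MeasurableSpace S] (K : Kernel S S) {f : S → ℝ}
    (hf : Measurable f) : Measurable (kernelOp K f) :=
  (hf.stronglyMeasurable.integral_kernel (κ := K)).measurable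

/-- Integrating against an invariant measure absorbs the kernel. -/
theorem integral_kernelOp_of_bind_eq {S : Type*} [MeasurableSpace S] {K : Kernel S S}
    {π : Measure S} (hπ : (π.bind fun x => K x) = π) {f : S → ℝ} (hf : Integrable f π) :
    ∫ x, kernelOp K f x ∂π = ∫ x, f x ∂π := by
  have hc : (K ∘ₖ Kernel.const Unit π) () = π := by
    rw [Kernel.comp_apply, Kernel.const_apply]
    exact hπ
  have h := Kernel.integral_comp (κ := Kernel.const Unit π) (η := K) (a := ()) (f := f)
    (by rwa [hc])
  rw [hc, Kernel.const_apply] at h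
  exact h.symm

/-- A minorized kernel contracts the range of bounded functions by the factor `1 - θ`. -/
theorem kernelOp_mem_Icc_of_minorization {S : Type*} [MeasurableSpace S]
    {K : Kernel S S} [IsMarkovKernel K] {θ : ℝ} (hθ0 : 0 ≤ θ)
    {ζ : Measure S} [IsProbabilityMeasure ζ]
    (hmin : ∀ x : S, ∀ A : Set S, MeasurableSet A → ENNReal.ofReal θ * ζ A ≤ K x A)
    {f : S → ℝ} (hf : Measurable f) {a b : ℝ} (hab : ∀ x, f x ∈ Set.Icc a b) (x : S) :
    kernelOp K f x ∈
      Set.Icc (θ * ∫ z, f z ∂ζ + (1 - θ) * a) (θ * ∫ z, f z ∂ζ + (1 - θ) * b) := by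
  have hle : ENNReal.ofReal θ • ζ ≤ K x :=
    Measure.le_iff.2 fun A hA => by simpa using hmin x A hA
  have hiK : Integrable f (K x) := integrable_of_measurable_of_mem_Icc hf hab
  have hiζ : Integrable f ζ := integrable_of_measurable_of_mem_Icc hf hab
  have h1 := integral_mono_measure (f := fun z => f z - a) hle
    (Filter.Eventually.of_forall fun z => sub_nonneg.2 (hab z).1)
    (hiK.sub (integrable_const a))
  have h2 := integral_mono_measure (f := fun z => b - f z) hle
    (Filter.Eventually.of_forall fun z => sub_nonneg.2 (hab z).2)
    ((integrable_const b).sub hiK)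
  rw [integral_smul_measure, integral_sub hiζ (integrable_const a),
    integral_sub hiK (integrable_const a), ENNReal.toReal_ofReal hθ0] at h1
  rw [integral_smul_measure, integral_sub (integrable_const b) hiζ,
    integral_sub (integrable_const b) hiK, ENNReal.toReal_ofReal hθ0] at h2
  simp only [integral_const, probReal_univ, smul_eq_mul, one_mul] at h1 h2
  constructor <;> simp only [kernelOp] <;> linarith

theorem kernelIter_succ {S : Type*} [MeasurableSpace S] (K : Kernel S S) (t : ℕ)
    (φ : S → ℝ) : kernelIter K (t + 1) φ = kernelOp K (kernelIter K t φ) :=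
  Function.iterate_succ_apply' _ _ _

theorem measurable_kernelIter {S : Type*} [MeasurableSpace S] (K : Kernel S S) {φ : S → ℝ}
    (hφ : Measurable φ) (t : ℕ) : Measurable (kernelIter K t φ) := by
  induction t with
  | zero => exact hφ
  | succ t ih =>
    rw [kernelIter_succ]
    exact measurable_kernelOp K ih

theorem exists_kernelIter_mem_Icc {S : Type*} [MeasurableSpace S]
    {K : Kernel S S} [IsMarkovKernel K] {θ : ℝ} (hθ0 : 0 ≤ θ)
    {ζ : Measure S} [IsProbabilityMeasure ζ]
    (hmin : ∀ x : S, ∀ A : Set S, MeasurableSet A → ENNReal.ofReal θ * ζ A ≤ K x A)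
    {φ : S → ℝ} (hφ : Measurable φ) {M : ℝ} (hM : ∀ x, |φ x| ≤ M) (t : ℕ) :
    ∃ a b : ℝ, b - a = 2 * M * (1 - θ) ^ t ∧ ∀ x, kernelIter K t φ x ∈ Set.Icc a b := by
  induction t with
  | zero => exact ⟨-M, M, by ring, fun x => abs_le.1 (hM x)⟩
  | succ t ih =>
    obtain ⟨a, b, hd, hab⟩ := ih
    rw [kernelIter_succ]
    refine ⟨_, _, ?_,
      kernelOp_mem_Icc_of_minorization hθ0 hmin (measurable_kernelIter K hφ t) hab⟩
    linear_combination (1 - θ) * hd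

theorem integral_kernelIter_of_bind_eq {S : Type*} [MeasurableSpace S]
    {K : Kernel S S} {π : Measure S} (hπ : (π.bind fun x => K x) = π) {φ : S → ℝ}
    (hi : ∀ t, Integrable (kernelIter K t φ) π) (t : ℕ) :
    ∫ x, kernelIter K t φ x ∂π = ∫ x, φ x ∂π := by
  induction t with
  | zero => rfl
  | succ t ih => rw [kernelIter_succ, integral_kernelOp_of_bind_eq hπ (hi t), ih]

/-- Geometric ergodicity in supremum norm under the Doeblin minorization. -/
theorem abs_kernelIter_sub_integral_le {S : Type*} [MeasurableSpace S]
    {K : Kernel S S} [IsMarkovKernel K] {θ : ℝ} (hθ0 : 0 ≤ θ)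
    {ζ : Measure S} [IsProbabilityMeasure ζ]
    (hmin : ∀ x : S, ∀ A : Set S, MeasurableSet A → ENNReal.ofReal θ * ζ A ≤ K x A)
    {π : Measure S} [IsProbabilityMeasure π] (hπ : (π.bind fun x => K x) = π)
    {φ : S → ℝ} (hφ : Measurable φ) {M : ℝ} (hM : ∀ x, |φ x| ≤ M) (t : ℕ) (x : S) :
    |kernelIter K t φ x - ∫ z, φ z ∂π| ≤ 2 * M * (1 - θ) ^ t := by
  have hi (t : ℕ) : Integrable (kernelIter K t φ) π := by
    obtain ⟨a, b, -, hab⟩ := exists_kernelIter_mem_Icc hθ0 hmin hφ hM t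
    exact integrable_of_measurable_of_mem_Icc (measurable_kernelIter K hφ t) hab
  obtain ⟨a, b, hd, hab⟩ := exists_kernelIter_mem_Icc hθ0 hmin hφ hM t
  rw [← integral_kernelIter_of_bind_eq hπ hi t, ← hd]
  have hint := integral_mem_Icc (μ := π) (measurable_kernelIter K hφ t) hab
  exact abs_sub_le_of_le_of_le (hab x).1 (hab x).2 hint.1 hint.2

/-- Well-posedness of the Poisson equation defining the asymptotic variance.
Under the Doeblin minorization `K(x,·) ≥ θ ζ(·)` with invariant probability `π`,
for every bounded measurable `φ` the series `φ̂(x) = Σ_t (K^t φ(x) − π(φ))` converges absolutely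
and uniformly in `x`; `φ̂` is bounded measurable with `‖φ̂‖_∞ ≤ 2‖φ‖_∞/θ`, and it solves
the Poisson equation `φ̂ − Kφ̂ = φ − π(φ)`. -/
theorem poisson_equation_wellposed {S : Type*} [MeasurableSpace S]
    (K : Kernel S S) [IsMarkovKernel K]
    (θ : ℝ) (hθ0 : 0 < θ) (hθ1 : θ ≤ 1)
    (ζ : Measure S) [IsProbabilityMeasure ζ]
    (hmin : ∀ x : S, ∀ A : Set S, MeasurableSet A → ENNReal.ofReal θ * ζ A ≤ K x A)
    (π : Measure S) [IsProbabilityMeasure π]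
    (hπinv : (π.bind fun x => K x) = π)
    (hπuniq : ∀ π' : Measure S, IsProbabilityMeasure π' → (π'.bind fun x => K x) = π' → π' = π)
    (φ : S → ℝ) (M : ℝ) (hφmeas : Measurable φ) (hφbd : ∀ x, |φ x| ≤ M) :
    (∀ x : S, Summable fun t : ℕ => |kernelIter K t φ x - ∫ z, φ z ∂π|) ∧
    TendstoUniformly
      (fun N : ℕ => fun x : S => ∑ t ∈ Finset.range N, (kernelIter K t φ x - ∫ z, φ z ∂π))
      (poissonSol K π φ) Filter.atTop ∧
    Measurable (poissonSol K π φ) ∧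
    (∀ x : S, |poissonSol K π φ x| ≤ 2 * M / θ) ∧
    (∀ x : S, poissonSol K π φ x - ∫ z, poissonSol K π φ z ∂(K x) = φ x - ∫ z, φ z ∂π) := by
  set c := ∫ z, φ z ∂π with hc
  have hbd := abs_kernelIter_sub_integral_le hθ0.le hmin hπinv hφmeas hφbd
  rw [← hc] at hbd
  have hgeo : HasSum (fun t : ℕ => 2 * M * (1 - θ) ^ t) (2 * M / θ) := by
    have h := (hasSum_geometric_of_lt_one (sub_nonneg.2 hθ1) (by linarith)).mul_left (2 * M)
    rwa [sub_sub_cancel, ← div_eq_mul_inv] at h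
  have hsum (x : S) : Summable fun t : ℕ => |kernelIter K t φ x - c| :=
    hgeo.summable.of_nonneg_of_le (fun _ => abs_nonneg _) fun t => hbd t x
  have hmeas (t : ℕ) : Measurable fun x => kernelIter K t φ x - c :=
    (measurable_kernelIter K hφmeas t).sub_const c
  have hunif : TendstoUniformly
      (fun N : ℕ => fun x : S => ∑ t ∈ Finset.range N, (kernelIter K t φ x - c))
      (poissonSol K π φ) Filter.atTop :=
    tendstoUniformly_tsum_nat hgeo.summable hbd
  refine ⟨hsum, hunif, ?_, fun x => ?_, fun x => ?_⟩
  · exact measurable_of_tendsto_metrizable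
      (fun N => Finset.measurable_fun_sum _ fun t _ => hmeas t)
      (tendsto_pi_nhds.2 hunif.tendsto_at)
  · exact tsum_of_norm_bounded (f := fun t => kernelIter K t φ x - c) hgeo fun t => hbd t x
  · have hint (t : ℕ) : Integrable (fun z => kernelIter K t φ z - c) (K x) :=
      integrable_of_measurable_of_mem_Icc (hmeas t) fun z => abs_le.1 (hbd t z)
    have hnorm : Summable fun t : ℕ => ∫ z, ‖kernelIter K t φ z - c‖ ∂(K x) := by
      refine hgeo.summable.of_nonneg_of_le
        (fun t => integral_nonneg fun z => norm_nonneg _) fun t => ?_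
      simpa using integral_mono (hint t).norm (integrable_const (2 * M * (1 - θ) ^ t)) (hbd t)
    have hstep (t : ℕ) :
        ∫ z, (kernelIter K t φ z - c) ∂(K x) = kernelIter K (t + 1) φ x - c := by
      have hi : Integrable (kernelIter K t φ) (K x) := by
        obtain ⟨a, b, -, hab⟩ := exists_kernelIter_mem_Icc hθ0.le hmin hφmeas hφbd t
        exact integrable_of_measurable_of_mem_Icc (measurable_kernelIter K hφmeas t) hab
      rw [kernelIter_succ, integral_sub hi (integrable_const c)]
      simp [kernelOp]
    have hK : ∫ z, poissonSol K π φ z ∂(K x) = ∑' t : ℕ, (kernelIter K (t + 1) φ x - c) := by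
      simp only [← hstep]
      exact (integral_tsum_of_summable_integral_norm hint hnorm).symm
    rw [hK, poissonSol, (hsum x).of_abs.tsum_eq_zero_add, add_sub_cancel_right]
    rfl
end

section
/- (Lipschitz continuity in total variation of the invariant measures along the tempering path; consequence of hypotheses (A1)–(A2).) Let (S,𝒮) be a measurable space and (K_s)_{s∈[0,1]} a family of Markov kernels on S such that: (i) there exist θ ∈ (0,1] and a probability measure ζ with K_s(x,·) ≥ θ ζ(·) for all s ∈ [0,1] and x ∈ S; (ii) there exists C < ∞ with sup_{x∈S} ‖K_s(x,·) − K_t(x,·)‖_TV ≤ C|s−t| for all s,t ∈ [0,1]. Let π_s denote the unique invariant probability measure of K_s (which exists by (i)). Then for all s, t ∈ [0,1]: ‖π_s − π_t‖_TV ≤ (C/θ) |s−t|. -/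
open MeasureTheory ProbabilityTheory

section TotalVariation

variable {α : Type*} [MeasurableSpace α]

theorem abs_real_sub_real_le_tvDist (μ ν : Measure α) [IsProbabilityMeasure μ]
    [IsProbabilityMeasure ν] {A : Set α} (hA : MeasurableSet A) :
    |μ.real A - ν.real A| ≤ tvDist μ ν := by
  refine le_ciSup (f := fun s : {s : Set α // MeasurableSet s} =>
    |(μ s.1).toReal - (ν s.1).toReal|) ⟨1, ?_⟩ ⟨A, hA⟩
  rintro _ ⟨B, rfl⟩
  exact abs_sub_le_of_nonneg_of_le ENNReal.toReal_nonneg measureReal_le_one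
    ENNReal.toReal_nonneg measureReal_le_one

theorem tvDist_le {μ ν : Measure α} {c : ℝ}
    (h : ∀ A, MeasurableSet A → |μ.real A - ν.real A| ≤ c) : tvDist μ ν ≤ c :=
  haveI : Nonempty {s : Set α // MeasurableSet s} := ⟨∅, MeasurableSet.empty⟩
  ciSup_le fun A => h A.1 A.2

theorem abs_integral_sub_integral_le_tvDist (μ ν : Measure α) [IsProbabilityMeasure μ]
    [IsProbabilityMeasure ν] {f : α → ℝ} (hf : Measurable f) {M : ℝ} (hM : 0 ≤ M)
    (hf0 : ∀ x, 0 ≤ f x) (hfM : ∀ x, f x ≤ M) :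
    |∫ x, f x ∂μ - ∫ x, f x ∂ν| ≤ M * tvDist μ ν := by
  have integrable_f (ρ : Measure α) [IsProbabilityMeasure ρ] : Integrable f ρ :=
    .of_mem_Icc 0 M hf.aemeasurable (.of_forall fun x => ⟨hf0 x, hfM x⟩)
  have integrable_tail (ρ : Measure α) [IsProbabilityMeasure ρ] :
      IntegrableOn (fun t => ρ.real {x | t ≤ f x}) (Set.Ioc 0 M) := by
    have anti : Antitone fun t => ρ.real {x | t ≤ f x} :=
      fun a b hab => measureReal_mono fun x (hx : b ≤ f x) => hab.trans hx
    exact .of_mem_Icc 0 1 anti.measurable.aemeasurable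
      (.of_forall fun t => ⟨measureReal_nonneg, measureReal_le_one⟩)
  rw [(integrable_f μ).integral_eq_integral_Ioc_meas_le (.of_forall hf0) (.of_forall hfM),
    (integrable_f ν).integral_eq_integral_Ioc_meas_le (.of_forall hf0) (.of_forall hfM),
    ← integral_sub (integrable_tail μ) (integrable_tail ν)]
  refine (norm_setIntegral_le_of_norm_le_const (C := tvDist μ ν)
    (f := fun t => μ.real {x | t ≤ f x} - ν.real {x | t ≤ f x}) measure_Ioc_lt_top fun t _ =>
      abs_real_sub_real_le_tvDist μ ν (measurableSet_le measurable_const hf)).trans_eq ?_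
  simp [hM, mul_comm]

end TotalVariation

section Kernel

variable {S : Type*} [MeasurableSpace S]

theorem measurable_kernel_real (κ : Kernel S S) {A : Set S} (hA : MeasurableSet A) :
    Measurable fun x => (κ x).real A :=
  (κ.measurable_coe hA).ennreal_toReal

theorem integrable_kernel_real (κ : Kernel S S) [IsMarkovKernel κ] (μ : Measure S)
    [IsFiniteMeasure μ] {A : Set S} (hA : MeasurableSet A) :
    Integrable (fun x => (κ x).real A) μ :=
  .of_mem_Icc 0 1 (measurable_kernel_real κ hA).aemeasurable
    (.of_forall fun _ => ⟨measureReal_nonneg, measureReal_le_one⟩)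

theorem bind_kernel_real_apply (κ : Kernel S S) [IsMarkovKernel κ] (μ : Measure S)
    {A : Set S} (hA : MeasurableSet A) :
    (μ.bind fun x => κ x).real A = ∫ x, (κ x).real A ∂μ := by
  rw [measureReal_def, Measure.bind_apply hA κ.aemeasurable]
  exact (integral_toReal (κ.measurable_coe hA).aemeasurable
    (.of_forall fun x => measure_lt_top _ _)).symm

/-- A Doeblin minorization with constant `θ` makes the kernel contract total variation by
`1 - θ`. -/
theorem abs_integral_kernel_sub_le_of_minorization (κ : Kernel S S) [IsMarkovKernel κ]
    {θ : ℝ} (hθ0 : 0 ≤ θ) (hθ1 : θ ≤ 1) (ζ : Measure S) [IsProbabilityMeasure ζ]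
    (hmin : ∀ x : S, ∀ A : Set S, MeasurableSet A → ENNReal.ofReal θ * ζ A ≤ κ x A)
    (μ ν : Measure S) [IsProbabilityMeasure μ] [IsProbabilityMeasure ν]
    {A : Set S} (hA : MeasurableSet A) :
    |∫ x, (κ x).real A ∂μ - ∫ x, (κ x).real A ∂ν| ≤ (1 - θ) * tvDist μ ν := by
  have minorization (x : S) {B : Set S} (hB : MeasurableSet B) :
      θ * ζ.real B ≤ (κ x).real B := by
    have h := ENNReal.toReal_mono (measure_ne_top _ _) (hmin x B hB)
    rwa [ENNReal.toReal_mul, ENNReal.toReal_ofReal hθ0] at h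
  have h := abs_integral_sub_integral_le_tvDist μ ν
    ((measurable_kernel_real κ hA).sub_const (θ * ζ.real A)) (sub_nonneg.2 hθ1)
    (fun x => sub_nonneg.2 (minorization x hA)) fun x => by
      have hc := minorization x hA.compl
      rw [probReal_compl_eq_one_sub hA, probReal_compl_eq_one_sub hA] at hc
      linarith
  rw [integral_sub (integrable_kernel_real κ μ hA) (integrable_const _),
    integral_sub (integrable_kernel_real κ ν hA) (integrable_const _)] at h
  simpa using h

end Kernel

/-- Lipschitz continuity in total variation of the invariant measures along
the tempering path. If the kernels `(K_s)_{s∈[0,1]}` satisfy a common Doeblin minorization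
`K_s(x,·) ≥ θ ζ(·)` and are TV-Lipschitz in `s` with constant `C`, then their invariant
probability measures satisfy `‖π_s − π_t‖_TV ≤ (C/θ)|s−t|`. -/
theorem invariant_measures_tv_lipschitz {S : Type*} [MeasurableSpace S]
    (K : ℝ → Kernel S S) (hK : ∀ s, IsMarkovKernel (K s))
    (θ : ℝ) (hθ0 : 0 < θ) (hθ1 : θ ≤ 1)
    (ζ : Measure S) [IsProbabilityMeasure ζ]
    (hmin : ∀ s ∈ Set.Icc (0:ℝ) 1, ∀ x : S, ∀ A : Set S, MeasurableSet A →
      ENNReal.ofReal θ * ζ A ≤ K s x A)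
    (C : ℝ) (hC : 0 ≤ C)
    (hLip : ∀ s ∈ Set.Icc (0:ℝ) 1, ∀ t ∈ Set.Icc (0:ℝ) 1, ∀ x : S,
      tvDist (K s x) (K t x) ≤ C * |s - t|)
    (π : ℝ → Measure S)
    (hπ : ∀ s ∈ Set.Icc (0:ℝ) 1,
      IsProbabilityMeasure (π s) ∧ ((π s).bind fun x => K s x) = π s) :
    ∀ s ∈ Set.Icc (0:ℝ) 1, ∀ t ∈ Set.Icc (0:ℝ) 1,
      tvDist (π s) (π t) ≤ (C / θ) * |s - t| := by
  intro s hs t ht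
  obtain ⟨hπs, inv_s⟩ := hπ s hs
  obtain ⟨hπt, inv_t⟩ := hπ t ht
  have := hK s
  have := hK t
  have key : tvDist (π s) (π t) ≤ (1 - θ) * tvDist (π s) (π t) + C * |s - t| := by
    refine tvDist_le fun A hA => ?_
    have contraction := abs_integral_kernel_sub_le_of_minorization (K s) hθ0.le hθ1 ζ
      (hmin s hs) (π s) (π t) hA
    have perturbation : |∫ x, (K s x).real A ∂π t - ∫ x, (K t x).real A ∂π t|
        ≤ C * |s - t| := by
      rw [← integral_sub (integrable_kernel_real _ _ hA) (integrable_kernel_real _ _ hA)]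
      simpa using norm_integral_le_of_norm_le_const (μ := π t)
        (f := fun x => (K s x).real A - (K t x).real A) (.of_forall fun x =>
          (abs_real_sub_real_le_tvDist (K s x) (K t x) hA).trans (hLip s hs t ht x))
    rw [← bind_kernel_real_apply (K s) (π s) hA, inv_s] at contraction
    rw [← bind_kernel_real_apply (K t) (π t) hA, inv_t] at perturbation
    exact (abs_sub_le _ _ _).trans (add_le_add contraction perturbation)
  rw [div_mul_eq_mul_div, le_div_iff₀ hθ0]
  linarith
end
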